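/- Let T, T_j, x, y be a TIP assignment satisfying constraints (0.1) and (0.2). Then the relation {(j,k) | k ∈ T_j and y_{j,k} = 1} is the graph of a bijection from T_1 onto T_2; consequently |T_1| = |T_2| and |T_s| = |T| − 2·|T_1|. -/

import Mathlib

open scoped Classical

/-- If a `{0,1}`-valued function has sum at most `1`, it takes the value `1` at most once. -/
theorem eq_of_sum_le_one {α : Type*} {s : Finset α} {f : α → ℤ}
    (hf : ∀ a ∈ s, f a = 0 ∨ f a = 1) (hs : ∑ a ∈ s, f a ≤ 1) {a b : α}
    (ha : a ∈ s) (hb : b ∈ s) (hfa : f a = 1) (hfb : f b = 1) : a = b := by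
  by_contra hab
  have hsub : ({a, b} : Finset α) ⊆ s := by
    intro c hc
    rcases Finset.mem_insert.1 hc with rfl | hc
    · exact ha
    · exact Finset.mem_singleton.1 hc ▸ hb
  have h := Finset.sum_le_sum_of_subset_of_nonneg hsub (f := f) fun i hi _ => by
    rcases hf i hi with h | h <;> omega
  rw [Finset.sum_pair hab] at h
  omega

/-- A value `1` of a `{0,1}`-valued function forces the sum to be at least `1`. -/
theorem one_le_sum_of_eq_one {α : Type*} {s : Finset α} {f : α → ℤ}
    (hf : ∀ a ∈ s, f a = 0 ∨ f a = 1) {a : α} (ha : a ∈ s) (hfa : f a = 1) :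
    1 ≤ ∑ b ∈ s, f b := by
  have h := Finset.single_le_sum (f := f) (fun i hi => by
    rcases hf i hi with h | h <;> omega) ha
  omega

/-- A `{0,1}`-valued function with sum `1` takes the value `1`. -/
theorem exists_eq_one_of_sum_eq_one {α : Type*} {s : Finset α} {f : α → ℤ}
    (hf : ∀ a ∈ s, f a = 0 ∨ f a = 1) (hs : ∑ a ∈ s, f a = 1) : ∃ a ∈ s, f a = 1 := by
  by_contra! h
  have := Finset.sum_eq_zero fun a ha => (hf a ha).resolve_right (h a ha)
  omega

/-- For a TIP assignment satisfying constraints (0.1) and (0.2),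
the relation `{(j,k) | k ∈ T_j and y j k = 1}` is the graph of a bijection from
`T₁` onto `T₂`; consequently `|T₁| = |T₂|` and `|Tₛ| = |T| - 2·|T₁|`. -/
theorem tip_transfer_bijection {ι : Type*} [DecidableEq ι]
    (T : Finset ι) (Tj : ι → Finset ι) (hTj : ∀ j ∈ T, Tj j ⊆ T)
    (x : ι → ℤ) (y : ι → ι → ℤ)
    (hx : ∀ j ∈ T, x j = 0 ∨ x j = 1)
    (hy : ∀ j ∈ T, ∀ k ∈ Tj j, y j k = 0 ∨ y j k = 1)
    (h01 : ∀ j ∈ T, ∑ k ∈ Tj j, y j k = x j)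
    (h02 : ∀ k ∈ T, ∑ j ∈ T.filter (fun j => k ∈ Tj j), y j k ≤ 1 - x k) :
    let T1 := T.filter (fun j => x j = 1)
    let T2 := T.filter (fun k => ∃ j ∈ T, k ∈ Tj j ∧ y j k = 1)
    let Ts := T \ (T1 ∪ T2)
    let R : ι → ι → Prop := fun j k => j ∈ T ∧ k ∈ Tj j ∧ y j k = 1
    (∀ j k, R j k → j ∈ T1 ∧ k ∈ T2) ∧
    (∀ j ∈ T1, ∃! k, R j k) ∧
    (∀ k ∈ T2, ∃! j, R j k) ∧
    T1.card = T2.card ∧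
    Ts.card = T.card - 2 * T1.card := by
  intro T1 T2 Ts R
  have hcol : ∀ k, ∀ j ∈ T.filter (fun j => k ∈ Tj j), y j k = 0 ∨ y j k = 1 := by
    intro k j hj
    rw [Finset.mem_filter] at hj
    exact hy j hj.1 k hj.2
  have hR : ∀ j k, R j k → j ∈ T1 ∧ k ∈ T2 := by
    rintro j k ⟨hj, hk, hyjk⟩
    refine ⟨Finset.mem_filter.2 ⟨hj, ?_⟩,
      Finset.mem_filter.2 ⟨hTj j hj hk, j, hj, hk, hyjk⟩⟩
    have h := one_le_sum_of_eq_one (hy j hj) hk hyjk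
    rw [h01 j hj] at h
    rcases hx j hj with h' | h' <;> omega
  have hfun : ∀ j ∈ T1, ∃! k, R j k := by
    intro j hj
    obtain ⟨hjT, hxj⟩ := Finset.mem_filter.1 hj
    have hsum := (h01 j hjT).trans hxj
    obtain ⟨k, hk, hyk⟩ := exists_eq_one_of_sum_eq_one (hy j hjT) hsum
    exact ⟨k, ⟨hjT, hk, hyk⟩, fun k' hk' =>
      eq_of_sum_le_one (hy j hjT) hsum.le hk'.2.1 hk hk'.2.2 hyk⟩
  have hinj : ∀ k ∈ T2, ∃! j, R j k := by
    intro k hk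
    obtain ⟨hkT, j, hj, hkj, hyj⟩ := Finset.mem_filter.1 hk
    have hsum : ∑ j ∈ T.filter (fun j => k ∈ Tj j), y j k ≤ 1 := by
      have h := h02 k hkT
      rcases hx k hkT with h' | h' <;> omega
    exact ⟨j, ⟨hj, hkj, hyj⟩, fun j' hj' =>
      eq_of_sum_le_one (hcol k) hsum (Finset.mem_filter.2 ⟨hj'.1, hj'.2.1⟩)
        (Finset.mem_filter.2 ⟨hj, hkj⟩) hj'.2.2 hyj⟩
  have hcard : T1.card = T2.card := by
    refine Finset.card_bij (fun j hj => (hfun j hj).choose)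
      (fun j hj => (hR _ _ (hfun j hj).choose_spec.1).2) ?_ ?_
    · intro i hi j hj hij
      have h1 := (hfun i hi).choose_spec.1
      have h2 := (hfun j hj).choose_spec.1
      rw [← hij] at h2
      exact (hinj _ (hR _ _ h1).2).unique h1 h2
    · intro k hk
      obtain ⟨j, hj, -⟩ := hinj k hk
      have hj1 := (hR _ _ hj).1
      exact ⟨j, hj1, (hfun j hj1).unique (hfun j hj1).choose_spec.1 hj⟩
  have hdisj : Disjoint T1 T2 := by
    rw [Finset.disjoint_left]
    intro k hk1 hk2
    obtain ⟨hkT, hxk⟩ := Finset.mem_filter.1 hk1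
    obtain ⟨-, j, hj, hkj, hyj⟩ := Finset.mem_filter.1 hk2
    have h1 := one_le_sum_of_eq_one (hcol k) (Finset.mem_filter.2 ⟨hj, hkj⟩) hyj
    have h2 := h02 k hkT
    omega
  refine ⟨hR, hfun, hinj, hcard, ?_⟩
  rw [Finset.card_sdiff_of_subset
    (Finset.union_subset (Finset.filter_subset _ _) (Finset.filter_subset _ _)),
    Finset.card_union_of_disjoint hdisj, ← hcard, two_mul]
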